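/- Let β > 0, σ > 0 and γ₁, γ₂ ≥ 0. Then sup_{x ∈ ℝ} |v^{γ₁}(x) − v^{γ₂}(x)| ≤ |γ₁ − γ₂| / β. -/

import Mathlib

open Real MeasureTheory Filter Topology

/-- At a local maximum the second derivative of a continuous function is nonpositive. -/
lemma IsLocalMax.deriv_deriv_nonpos {f : ℝ → ℝ} {a : ℝ} (h : IsLocalMax f a)
    (hc : ContinuousAt f a) : deriv (deriv f) a ≤ 0 := by
  by_contra! hpos
  have hmin : IsLocalMin f a := isLocalMin_of_deriv_deriv_pos hpos h.deriv_eq_zero hc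
  have heq : f =ᶠ[𝓝 a] fun _ => f a := by
    filter_upwards [h, hmin] with x hx hx' using le_antisymm hx hx'
  have := heq.deriv.deriv_eq
  simp at this
  exact hpos.ne' this

/-- A continuous periodic real function attains its maximum. -/
lemma Function.Periodic.exists_forall_le {f : ℝ → ℝ} {c : ℝ} (hf : Function.Periodic f c)
    (hc : c ≠ 0) (hcont : Continuous f) : ∃ a, ∀ x, f x ≤ f a := by
  obtain ⟨_, ⟨a, rfl⟩, ha⟩ :=
    (hf.compact_of_continuous hc hcont).exists_isGreatest (Set.range_nonempty f)
  exact ⟨a, fun x => ha ⟨x, rfl⟩⟩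

/-- Comparison principle for periodic solutions of `β u - κ u'' + (u')² / 2 = g`. -/
lemma sub_le_of_periodic_hjb {β κ c C : ℝ} (hβ : 0 < β) (hκ : 0 ≤ κ) (hc : c ≠ 0)
    {u w g h : ℝ → ℝ} (hu : Function.Periodic u c) (hw : Function.Periodic w c)
    (hu2 : ContDiff ℝ 2 u) (hw2 : ContDiff ℝ 2 w)
    (hgu : ∀ x, β * u x - κ * deriv (deriv u) x + (1 / 2) * (deriv u x) ^ 2 = g x)
    (hhw : ∀ x, β * w x - κ * deriv (deriv w) x + (1 / 2) * (deriv w x) ^ 2 = h x)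
    (hgh : ∀ x, g x - h x ≤ C) (x : ℝ) : u x - w x ≤ C / β := by
  have hcont : Continuous (u - w) := hu2.continuous.sub hw2.continuous
  obtain ⟨a, ha⟩ := (hu.sub hw).exists_forall_le hc hcont
  have hmax : IsLocalMax (u - w) a := Eventually.of_forall ha
  have du : Differentiable ℝ u := hu2.differentiable (by norm_num)
  have dw : Differentiable ℝ w := hw2.differentiable (by norm_num)
  have hderiv : deriv (u - w) = deriv u - deriv w := funext fun y => deriv_sub (du y) (dw y)
  have h1 : deriv u a = deriv w a := by
    have := hmax.deriv_eq_zero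
    rw [hderiv] at this
    exact sub_eq_zero.1 this
  have h2 : deriv (deriv u) a - deriv (deriv w) a ≤ 0 := by
    have := hmax.deriv_deriv_nonpos hcont.continuousAt
    rwa [hderiv, deriv_sub (hu2.differentiable_deriv_two a) (hw2.differentiable_deriv_two a)]
      at this
  have hx : u x - w x ≤ u a - w a := ha x
  refine hx.trans ((le_div_iff₀ hβ).2 ?_)
  have e1 := hgu a
  have e2 := hhw a
  rw [h1] at e1
  nlinarith [hgh a, mul_nonpos_of_nonneg_of_nonpos hκ h2]


/-- `sup_x |v^{γ₁}(x) − v^{γ₂}(x)| ≤ |γ₁ − γ₂|/β`. -/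
theorem kuramoto_value_lipschitz_in_gamma
    (β σ : ℝ) (hβ : 0 < β) (hσ : 0 < σ)
    (v : ℝ → ℝ → ℝ)
    (hper : ∀ γ, 0 ≤ γ → Function.Periodic (v γ) (2 * π))
    (hC2 : ∀ γ, 0 ≤ γ → ContDiff ℝ 2 (v γ))
    (hODE : ∀ γ, 0 ≤ γ → ∀ x : ℝ,
      β * v γ x - σ ^ 2 / 2 * deriv (deriv (v γ)) x + (1 / 2) * (deriv (v γ) x) ^ 2
        = -γ * Real.cos x)
    (γ₁ γ₂ : ℝ) (hγ₁ : 0 ≤ γ₁) (hγ₂ : 0 ≤ γ₂) :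
    ∀ x : ℝ, |v γ₁ x - v γ₂ x| ≤ |γ₁ - γ₂| / β := by
  have key : ∀ a b : ℝ, 0 ≤ a → 0 ≤ b → ∀ x, v a x - v b x ≤ |a - b| / β := by
    intro a b ha hb
    refine sub_le_of_periodic_hjb hβ (by positivity) two_pi_pos.ne' (hper a ha) (hper b hb)
      (hC2 a ha) (hC2 b hb) (hODE a ha) (hODE b hb) fun x => ?_
    calc -a * cos x - -b * cos x = -((a - b) * cos x) := by ring
      _ ≤ |(a - b) * cos x| := neg_le_abs _
      _ = |a - b| * |cos x| := abs_mul _ _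
      _ ≤ |a - b| := mul_le_of_le_one_right (abs_nonneg _) (abs_cos_le_one x)
  intro x
  refine abs_sub_le_iff.2 ⟨key _ _ hγ₁ hγ₂ x, ?_⟩
  rw [abs_sub_comm]
  exact key _ _ hγ₂ hγ₁ x
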